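/- Let M = (M_k)_{k≥0} be a regular sequence with constants A, H as in the definition, and let M(t) = sup_{k≥0} log(t^k/M_k) be its associated function. Let N ≥ 1 and k ≥ 1 be integers, x₀ ∈ ℝ^N, a > 0, 𝒞 ⊆ ℝ^N measurable, and let g be a continuous function on {τ ∈ ℝ^N : |τ − x₀| ≤ a} × 𝒞 with |g(τ, ξ)| ≤ C e^{−M(c|ξ|)} for some constants C, c > 0 and all (τ, ξ) in this set. Then F₁(x) = (2π)^{−N} ∫_{{|τ − x₀| ≤ a}} ∫_{𝒞} e^{iξ·(x − τ)} g(τ, ξ) |ξ|^{N/(2k)} dξ dτ is a C^∞ function on ℝ^N, and there exist constants C̃ > 0 and h > 0 such that sup_{x ∈ ℝ^N} |∂^α F₁(x)| ≤ C̃ h^{|α|} M_{|α|} for every multi-index α. -/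

import Mathlib

open MeasureTheory Metric Complex Filter

noncomputable section

/-- The dot product `x · y = ∑ j, x j * y j` on `ℝ^N`. -/
def dotR {N : ℕ} (x y : EuclideanSpace ℝ (Fin N)) : ℝ := ∑ j, x j * y j

/-- Iterated partial derivative along a list of coordinate directions. -/
def pderivList {N : ℕ} : List (Fin N) → (EuclideanSpace ℝ (Fin N) → ℂ) →
    EuclideanSpace ℝ (Fin N) → ℂ
  | [], f => f
  | j :: l, f => fun x => fderiv ℝ (pderivList l f) x (EuclideanSpace.single j 1)

/-- The partial derivative `∂^α` for a multi-index `α : Fin N → ℕ`. -/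
def pderivMulti {N : ℕ} (α : Fin N → ℕ) (f : EuclideanSpace ℝ (Fin N) → ℂ) :
    EuclideanSpace ℝ (Fin N) → ℂ :=
  pderivList ((List.finRange N).flatMap fun j => List.replicate (α j) j) f

/-- A regular sequence `M = (M_k)` with stability constants `A, H`:
`M₀ = M₁ = 1`, `(M_k/k!)` is log-convex, `M_k ≤ A H^k M_{k-1}`, and
`(M_k/k!)^{1/k} → ∞`. -/
structure RegularSeq (M : ℕ → ℝ) (A H : ℝ) : Prop where
  pos : ∀ n, 0 < M n
  m0 : M 0 = 1
  m1 : M 1 = 1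
  logconvex : ∀ n : ℕ, (M (n + 1) / (Nat.factorial (n + 1) : ℝ)) ^ 2 ≤
    (M n / (Nat.factorial n : ℝ)) * (M (n + 2) / (Nat.factorial (n + 2) : ℝ))
  Apos : 0 < A
  Hpos : 0 < H
  stab : ∀ n : ℕ, M (n + 1) ≤ A * H ^ (n + 1) * M n
  root_tendsto : Filter.Tendsto (fun n : ℕ => (M n / (Nat.factorial n : ℝ)) ^ ((1 : ℝ) / n))
    Filter.atTop Filter.atTop

/-- The associated function `M(t) = sup_k log (t^k / M_k)`. -/
def assocFn (M : ℕ → ℝ) (t : ℝ) : ℝ := ⨆ n : ℕ, Real.log (t ^ n / M n)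

section helpers14

variable {N : ℕ}

theorem dotR_eq_inner (x y : EuclideanSpace ℝ (Fin N)) : dotR x y = inner ℝ x y := by
  simp [dotR, PiLp.inner_apply, mul_comm]

/-- Oscillatory integral. -/
def oscInt {Ω : Type*} [MeasurableSpace Ω] (μ : Measure Ω) (ξ : Ω → EuclideanSpace ℝ (Fin N))
    (G : Ω → ℂ) (x : EuclideanSpace ℝ (Fin N)) : ℂ :=
  ∫ ω, Complex.exp (Complex.I * ((inner ℝ (ξ ω) x : ℝ) : ℂ)) * G ω ∂μ

/-- Admissible amplitude. -/
structure Adm {Ω : Type*} [MeasurableSpace Ω] (μ : Measure Ω)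
    (ξ : Ω → EuclideanSpace ℝ (Fin N)) (G : Ω → ℂ) : Prop where
  mξ : Measurable ξ
  mG : AEStronglyMeasurable G μ
  int : ∀ n : ℕ, Integrable (fun ω => ‖ξ ω‖ ^ n * ‖G ω‖) μ

variable {Ω : Type*} [MeasurableSpace Ω] {μ : Measure Ω}
    {ξ : Ω → EuclideanSpace ℝ (Fin N)} {G : Ω → ℂ}

theorem norm_osc (t : ℝ) : ‖Complex.exp (Complex.I * (t : ℂ))‖ = 1 := by
  rw [mul_comm]; exact Complex.norm_exp_ofReal_mul_I t

theorem meas_osc (hξ : Measurable ξ) (x : EuclideanSpace ℝ (Fin N)) :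
    Measurable (fun ω => Complex.exp (Complex.I * ((inner ℝ (ξ ω) x : ℝ) : ℂ))) := by
  have : Measurable (fun ω => (inner ℝ (ξ ω) x : ℝ)) := hξ.inner measurable_const
  fun_prop

theorem Adm.mulI (h : Adm μ ξ G) (v : EuclideanSpace ℝ (Fin N)) :
    Adm μ ξ (fun ω => Complex.I * ((inner ℝ (ξ ω) v : ℝ) : ℂ) * G ω) := by
  have hm : Measurable (fun ω => (inner ℝ (ξ ω) v : ℝ)) := h.mξ.inner measurable_const
  have hm2 : Measurable (fun ω => Complex.I * ((inner ℝ (ξ ω) v : ℝ) : ℂ)) := by fun_prop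
  have hmG : AEStronglyMeasurable (fun ω => Complex.I * ((inner ℝ (ξ ω) v : ℝ) : ℂ) * G ω) μ :=
    hm2.aestronglyMeasurable.mul h.mG
  refine ⟨h.mξ, hmG, fun n => ?_⟩
  refine Integrable.mono' ((h.int (n+1)).const_mul ‖v‖) ?_ ?_
  · exact ((h.mξ.norm.pow_const n).aestronglyMeasurable).mul hmG.norm
  · refine Filter.Eventually.of_forall fun ω => ?_
    have h1 : |inner ℝ (ξ ω) v| ≤ ‖ξ ω‖ * ‖v‖ := abs_real_inner_le_norm _ _
    rw [Real.norm_of_nonneg (by positivity)]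
    simp only [norm_mul, Complex.norm_I, one_mul, Complex.norm_real, Real.norm_eq_abs]
    calc ‖ξ ω‖ ^ n * (|inner ℝ (ξ ω) v| * ‖G ω‖)
        ≤ ‖ξ ω‖ ^ n * ((‖ξ ω‖ * ‖v‖) * ‖G ω‖) := by gcongr
      _ = _ := by ring

theorem Adm.integrable (h : Adm μ ξ G) (x : EuclideanSpace ℝ (Fin N)) :
    Integrable (fun ω => Complex.exp (Complex.I * ((inner ℝ (ξ ω) x : ℝ) : ℂ)) * G ω) μ := by
  refine Integrable.mono' (h.int 0) ((meas_osc h.mξ x).aestronglyMeasurable.mul h.mG) ?_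
  refine Filter.Eventually.of_forall fun ω => ?_
  simp only [norm_mul, norm_osc]
  simp

/-- The derivative of the integrand. -/
def oscD (ξ : Ω → EuclideanSpace ℝ (Fin N)) (G : Ω → ℂ) (x : EuclideanSpace ℝ (Fin N)) (ω : Ω) :
    EuclideanSpace ℝ (Fin N) →L[ℝ] ℂ :=
  (Complex.exp (Complex.I * ((inner ℝ (ξ ω) x : ℝ) : ℂ)) * G ω * Complex.I) •
    (Complex.ofRealCLM.comp (innerSL ℝ (ξ ω)))

theorem oscD_meas (h : Adm μ ξ G) (x : EuclideanSpace ℝ (Fin N)) :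
    AEStronglyMeasurable (oscD ξ G x) μ := by
  unfold oscD
  have hA : AEStronglyMeasurable (fun ω => Complex.exp (Complex.I * ((inner ℝ (ξ ω) x : ℝ) : ℂ)) *
      G ω * Complex.I) μ := ((meas_osc h.mξ x).aestronglyMeasurable.mul h.mG).mul aestronglyMeasurable_const
  have hB : AEStronglyMeasurable (fun ω => Complex.ofRealCLM.comp (innerSL ℝ (ξ ω))) μ := by
    have hc : Continuous (fun y : EuclideanSpace ℝ (Fin N) =>
        Complex.ofRealCLM.comp (innerSL ℝ y)) :=
      continuous_const.clm_comp (innerSL ℝ).continuous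
    exact hc.comp_aestronglyMeasurable h.mξ.aestronglyMeasurable
  exact hA.smul hB

theorem oscD_norm (x : EuclideanSpace ℝ (Fin N)) (ω : Ω) :
    ‖oscD ξ G x ω‖ ≤ ‖ξ ω‖ ^ 1 * ‖G ω‖ := by
  unfold oscD
  rw [norm_smul]
  simp only [norm_mul, norm_osc, Complex.norm_I, one_mul, mul_one, pow_one]
  rw [mul_comm]
  gcongr
  refine (ContinuousLinearMap.opNorm_comp_le _ _).trans ?_
  simp

theorem oscInt_hasFDerivAt (h : Adm μ ξ G) (x : EuclideanSpace ℝ (Fin N)) :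
    HasFDerivAt (oscInt μ ξ G) (∫ ω, oscD ξ G x ω ∂μ) x := by
  refine hasFDerivAt_integral_of_dominated_of_fderiv_le (s := Set.univ)
    (bound := fun ω => ‖ξ ω‖ ^ 1 * ‖G ω‖) Filter.univ_mem ?_ (h.integrable x) (oscD_meas h x) ?_
    (h.int 1) ?_
  · exact Filter.Eventually.of_forall fun y => (h.integrable y).aestronglyMeasurable
  · exact Filter.Eventually.of_forall fun ω y _ => oscD_norm y ω
  · refine Filter.Eventually.of_forall fun ω y _ => ?_
    have h1 : HasFDerivAt (fun y => ((inner ℝ (ξ ω) y : ℝ) : ℂ))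
        (Complex.ofRealCLM.comp (innerSL ℝ (ξ ω))) y :=
      (Complex.ofRealCLM.comp (innerSL ℝ (ξ ω))).hasFDerivAt
    have h2 := ((h1.const_mul Complex.I).cexp).mul_const (G ω)
    have heq : oscD ξ G y ω = G ω • Complex.exp (Complex.I * ((inner ℝ (ξ ω) y : ℝ) : ℂ)) •
        Complex.I • (Complex.ofRealCLM.comp (innerSL ℝ (ξ ω))) := by
      unfold oscD
      rw [smul_smul, smul_smul]
      congr 1
      ring
    rw [heq]
    exact h2

theorem oscInt_fderiv (h : Adm μ ξ G) (x v : EuclideanSpace ℝ (Fin N)) :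
    fderiv ℝ (oscInt μ ξ G) x v =
      oscInt μ ξ (fun ω => Complex.I * ((inner ℝ (ξ ω) v : ℝ) : ℂ) * G ω) x := by
  rw [(oscInt_hasFDerivAt h x).fderiv, ContinuousLinearMap.integral_apply]
  · unfold oscInt
    congr 1
    ext ω
    simp [oscD]
    ring
  · refine Integrable.mono' (h.int 1) (oscD_meas h x) ?_
    exact Filter.Eventually.of_forall fun ω => oscD_norm x ω

theorem oscInt_contDiff_nat (n : ℕ) : ∀ G : Ω → ℂ, Adm μ ξ G → ContDiff ℝ n (oscInt μ ξ G) := by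
  induction n with
  | zero =>
    intro G h
    have : Differentiable ℝ (oscInt μ ξ G) := fun x => (oscInt_hasFDerivAt h x).differentiableAt
    simpa using (contDiff_zero (𝕜 := ℝ)).2 this.continuous
  | succ n ih =>
    intro G h
    push_cast
    rw [contDiff_succ_iff_fderiv_apply]
    refine ⟨fun x => (oscInt_hasFDerivAt h x).differentiableAt, by simp, fun v => ?_⟩
    simp_rw [oscInt_fderiv h]
    exact ih _ (h.mulI v)

/-- Amplitude after differentiating along a list. -/
def ampl (ξ : Ω → EuclideanSpace ℝ (Fin N)) (G : Ω → ℂ) : List (Fin N) → Ω → ℂ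
  | [] => G
  | j :: l => fun ω => Complex.I *
      ((inner ℝ (ξ ω) (EuclideanSpace.single j (1:ℝ)) : ℝ) : ℂ) * ampl ξ G l ω

theorem ampl_adm (h : Adm μ ξ G) : ∀ l : List (Fin N), Adm μ ξ (ampl ξ G l)
  | [] => h
  | j :: l => (ampl_adm h l).mulI _

theorem ampl_norm : ∀ (l : List (Fin N)) (ω : Ω), ‖ampl ξ G l ω‖ ≤ ‖ξ ω‖ ^ l.length * ‖G ω‖
  | [], ω => by simp [ampl]
  | j :: l, ω => by
    have ih := ampl_norm l ω
    have h1 : |inner ℝ (ξ ω) (EuclideanSpace.single j (1:ℝ))| ≤ ‖ξ ω‖ := by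
      simpa using abs_real_inner_le_norm (ξ ω) (EuclideanSpace.single j (1:ℝ))
    simp only [ampl, norm_mul, Complex.norm_I, one_mul, Complex.norm_real, Real.norm_eq_abs,
      List.length_cons]
    calc _ ≤ ‖ξ ω‖ * (‖ξ ω‖ ^ l.length * ‖G ω‖) := by gcongr
      _ = _ := by ring

theorem pderivList_oscInt (h : Adm μ ξ G) : ∀ l : List (Fin N),
    pderivList l (oscInt μ ξ G) = oscInt μ ξ (ampl ξ G l)
  | [] => rfl
  | j :: l => by
    funext x
    simp only [pderivList, pderivList_oscInt h l, oscInt_fderiv (ampl_adm h l)]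
    rfl

theorem pderivList_oscInt_norm (h : Adm μ ξ G) (l : List (Fin N))
    (x : EuclideanSpace ℝ (Fin N)) :
    ‖pderivList l (oscInt μ ξ G) x‖ ≤ ∫ ω, ‖ξ ω‖ ^ l.length * ‖G ω‖ ∂μ := by
  rw [pderivList_oscInt h]
  refine norm_integral_le_of_norm_le (h.int _) (Filter.Eventually.of_forall fun ω => ?_)
  rw [norm_mul, norm_osc, one_mul]
  exact ampl_norm l ω

theorem assoc_bdd {M : ℕ → ℝ} {A H : ℝ} (hr : RegularSeq M A H) {t : ℝ} (ht : 0 ≤ t) :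
    BddAbove (Set.range fun n : ℕ => Real.log (t ^ n / M n)) := by
  apply Filter.IsBoundedUnder.bddAbove_range
  refine ⟨0, ?_⟩
  rw [Filter.eventually_map]
  filter_upwards [hr.root_tendsto.eventually_ge_atTop t, Filter.eventually_ge_atTop 1] with n hn h1
  have hM := hr.pos n
  have hf : (1:ℝ) ≤ (Nat.factorial n : ℝ) := by exact_mod_cast Nat.factorial_pos n
  have h2 : t ^ n ≤ M n / (Nat.factorial n : ℝ) := by
    calc t ^ n ≤ ((M n / (Nat.factorial n : ℝ)) ^ ((1 : ℝ) / n)) ^ n := by gcongr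
      _ = _ := by
        rw [one_div]
        exact Real.rpow_inv_natCast_pow (by positivity) (by omega)
  apply Real.log_nonpos (by positivity)
  rw [div_le_one hM]
  exact h2.trans (div_le_self hM.le hf)

theorem assoc_le {M : ℕ → ℝ} {A H : ℝ} (hr : RegularSeq M A H) {t : ℝ} (ht : 0 ≤ t) (n : ℕ) :
    t ^ n * Real.exp (-(assocFn M t)) ≤ M n := by
  have hM := hr.pos n
  rcases (pow_nonneg ht n).eq_or_lt with h0 | h0
  · rw [← h0]; simpa using hM.le
  · have h1 : Real.log (t ^ n / M n) ≤ assocFn M t := le_ciSup (assoc_bdd hr ht) n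
    rw [Real.log_le_iff_le_exp (by positivity), div_le_iff₀ hM] at h1
    rw [Real.exp_neg, ← div_eq_mul_inv, div_le_iff₀ (Real.exp_pos _)]
    linarith

theorem stab_iter {M : ℕ → ℝ} {A H : ℝ} (hr : RegularSeq M A H) (q : ℕ) :
    ∃ B > (0:ℝ), ∃ h > (0:ℝ), ∀ n, M (n + q) ≤ B * h ^ n * M n := by
  have hA := hr.Apos
  have hH := hr.Hpos
  induction q with
  | zero => exact ⟨1, one_pos, 1, one_pos, fun n => by simp⟩
  | succ q ih =>
    obtain ⟨B, hB, h, hh, ih⟩ := ih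
    refine ⟨A * H ^ (q + 1) * B, by positivity, H * h, by positivity, fun n => ?_⟩
    calc M (n + (q + 1)) ≤ A * H ^ (n + q + 1) * M (n + q) := hr.stab (n + q)
      _ ≤ A * H ^ (n + q + 1) * (B * h ^ n * M n) := by
        gcongr
        exact ih n
      _ = _ := by rw [mul_pow]; ring

/-- Key decay estimate. -/
theorem decay {M : ℕ → ℝ} {A H : ℝ} (hr : RegularSeq M A H) {c : ℝ} (hc : 0 < c) (q : ℕ) :
    ∃ B > (0:ℝ), ∃ h > (0:ℝ), ∀ n : ℕ, ∀ r : ℝ, 0 ≤ r →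
      (1 + r) ^ q * (r ^ n * Real.exp (-(assocFn M (c * r)))) ≤ B * h ^ n * M n := by
  obtain ⟨B, hB, h, hh, hq⟩ := stab_iter hr q
  refine ⟨2 ^ (q - 1) * (1 + (c⁻¹) ^ q * B), by positivity, c⁻¹ * (1 + h), by positivity,
    fun n r hr0 => ?_⟩
  have hM := hr.pos n
  set e := Real.exp (-(assocFn M (c * r))) with he
  have hepos : 0 < e := Real.exp_pos _
  have key : ∀ m, r ^ m * e ≤ (c⁻¹) ^ m * M m := fun m => by
    have := assoc_le hr (mul_nonneg hc.le hr0) m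
    rw [← he, mul_pow] at this
    calc r ^ m * e = (c⁻¹) ^ m * (c ^ m * r ^ m * e) := by
          rw [inv_pow]; field_simp
      _ ≤ _ := by gcongr
  have h1 : (1 + r) ^ q ≤ 2 ^ (q - 1) * (1 + r ^ q) := by
    simpa using add_pow_le zero_le_one hr0 q
  have e1 : h ^ n ≤ (1 + h) ^ n := by gcongr; linarith
  have e2 : 1 ≤ (1 + h) ^ n := one_le_pow₀ (by linarith)
  calc (1 + r) ^ q * (r ^ n * e) ≤ 2 ^ (q - 1) * (1 + r ^ q) * (r ^ n * e) := by gcongr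
    _ = 2 ^ (q - 1) * (r ^ n * e + r ^ (n + q) * e) := by ring
    _ ≤ 2 ^ (q - 1) * ((c⁻¹) ^ n * M n + (c⁻¹) ^ (n + q) * (B * h ^ n * M n)) := by
        refine mul_le_mul_of_nonneg_left (add_le_add (key n) ((key (n + q)).trans ?_))
          (by positivity)
        exact mul_le_mul_of_nonneg_left (hq n) (by positivity)
    _ = 2 ^ (q - 1) * ((c⁻¹) ^ n * (1 * M n) + (c⁻¹) ^ (n + q) * (B * h ^ n * M n)) := by ring
    _ ≤ 2 ^ (q - 1) * ((c⁻¹) ^ n * ((1 + h) ^ n * M n) +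
          (c⁻¹) ^ (n + q) * (B * (1 + h) ^ n * M n)) := by
        gcongr
    _ = _ := by rw [mul_pow]; ring

theorem length_multi (α : Fin N → ℕ) :
    ((List.finRange N).flatMap fun j => List.replicate (α j) j).length = ∑ j, α j := by
  simp [List.length_flatMap, List.sum_ofFn, ← List.ofFn_eq_map]

end helpers14

/-- If `|g(τ,ξ)| ≤ C e^{-M(c|ξ|)}` for a regular sequence `M`, then
`F₁` is `C^∞` and satisfies Denjoy–Carleman estimates
`sup_x |∂^α F₁(x)| ≤ C̃ h^{|α|} M_{|α|}`. -/
theorem stmt14 (Mseq : ℕ → ℝ) (A H : ℝ) (hreg : RegularSeq Mseq A H)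
    (N k : ℕ) (hN : 1 ≤ N) (hk : 1 ≤ k)
    (x₀ : EuclideanSpace ℝ (Fin N)) (a : ℝ) (ha : 0 < a)
    (𝒞 : Set (EuclideanSpace ℝ (Fin N))) (h𝒞 : MeasurableSet 𝒞)
    (g : EuclideanSpace ℝ (Fin N) → EuclideanSpace ℝ (Fin N) → ℂ)
    (hgcont : ContinuousOn (fun q : EuclideanSpace ℝ (Fin N) × EuclideanSpace ℝ (Fin N) =>
      g q.1 q.2) (Metric.closedBall x₀ a ×ˢ 𝒞))
    (C c : ℝ) (hC : 0 < C) (hc : 0 < c)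
    (hg : ∀ τ ∈ Metric.closedBall x₀ a, ∀ ξ ∈ 𝒞,
      ‖g τ ξ‖ ≤ C * Real.exp (-(assocFn Mseq (c * ‖ξ‖))))
    (F₁ : EuclideanSpace ℝ (Fin N) → ℂ)
    (hF₁ : ∀ x, F₁ x = (((2 * Real.pi) ^ N)⁻¹ : ℝ) •
      ∫ τ in Metric.closedBall x₀ a, ∫ ξ in 𝒞,
        Complex.exp (Complex.I * ((dotR ξ (x - τ) : ℝ) : ℂ)) * g τ ξ *
          ((‖ξ‖ ^ ((N : ℝ) / (2 * k)) : ℝ) : ℂ)) :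
    ContDiff ℝ (⊤ : ℕ∞) F₁ ∧
    ∃ Ct > (0 : ℝ), ∃ h > (0 : ℝ), ∀ (α : Fin N → ℕ) (x : EuclideanSpace ℝ (Fin N)),
      ‖pderivMulti α F₁ x‖ ≤ Ct * h ^ (∑ j, α j) * Mseq (∑ j, α j) := by
  obtain ⟨B, hB, h, hh, hdec⟩ := decay hreg hc (2 * N + 1)
  set s : ℝ := (N : ℝ) / (2 * k) with hs
  have hs0 : 0 ≤ s := by positivity
  have hsN : s ≤ N := by
    have : (1:ℝ) ≤ k := by exact_mod_cast hk
    exact div_le_self (by positivity) (by linarith)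
  set D : ℝ := ((2 * Real.pi) ^ N)⁻¹ with hD
  have hDpos : 0 < D := by positivity
  set μ : Measure (EuclideanSpace ℝ (Fin N) × EuclideanSpace ℝ (Fin N)) :=
    (volume.restrict (closedBall x₀ a)).prod (volume.restrict 𝒞) with hμ
  have hμr : μ = (volume.prod volume).restrict (closedBall x₀ a ×ˢ 𝒞) :=
    Measure.prod_restrict _ _
  have hms : MeasurableSet (closedBall x₀ a ×ˢ 𝒞) := measurableSet_closedBall.prod h𝒞
  haveI : IsFiniteMeasure (volume.restrict (closedBall x₀ a)) :=
    ⟨by simpa using measure_closedBall_lt_top⟩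
  set G : EuclideanSpace ℝ (Fin N) × EuclideanSpace ℝ (Fin N) → ℂ := fun q =>
    (D : ℂ) * (Complex.exp (Complex.I * ((-(inner ℝ q.2 q.1) : ℝ) : ℂ)) * g q.1 q.2 *
      ((‖q.2‖ ^ s : ℝ) : ℂ)) with hG
  set ρ : EuclideanSpace ℝ (Fin N) → ℝ := fun ξ => (1 + ‖ξ‖) ^ (-((N : ℝ) + 1)) with hρ
  have hρi : Integrable (fun q : EuclideanSpace ℝ (Fin N) × EuclideanSpace ℝ (Fin N) => ρ q.2) μ := by
    have : Integrable ρ (volume.restrict 𝒞) :=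
      (integrable_one_add_norm (by simp)).restrict
    exact this.comp_snd _
  have hGm : AEStronglyMeasurable G μ := by
    have h1 : AEStronglyMeasurable (fun q : EuclideanSpace ℝ (Fin N) × EuclideanSpace ℝ (Fin N) =>
        g q.1 q.2) μ := by
      rw [hμr]; exact hgcont.aestronglyMeasurable hms
    have h2 : Continuous (fun q : EuclideanSpace ℝ (Fin N) × EuclideanSpace ℝ (Fin N) =>
        Complex.exp (Complex.I * ((-(inner ℝ q.2 q.1) : ℝ) : ℂ))) := by fun_prop
    have h3 : Continuous (fun q : EuclideanSpace ℝ (Fin N) × EuclideanSpace ℝ (Fin N) =>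
        ((‖q.2‖ ^ s : ℝ) : ℂ)) :=
      Complex.continuous_ofReal.comp (continuous_snd.norm.rpow_const fun _ => Or.inr hs0)
    exact ((h2.aestronglyMeasurable.mul h1).mul h3.aestronglyMeasurable).const_mul _
  have hbound : ∀ n : ℕ, ∀ᵐ q ∂μ, ‖q.2‖ ^ n * ‖G q‖ ≤ (D * C * B * h ^ n * Mseq n) * ρ q.2 := by
    intro n
    rw [hμr]
    refine (ae_restrict_iff' hms).2 (Filter.Eventually.of_forall fun q hq => ?_)
    have hgq := hg q.1 hq.1 q.2 hq.2
    have hd := hdec n ‖q.2‖ (norm_nonneg _)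
    have hr1 : (1:ℝ) ≤ 1 + ‖q.2‖ := by linarith [norm_nonneg q.2]
    have hr0 : (0:ℝ) < 1 + ‖q.2‖ := by linarith
    have hsq : ‖q.2‖ ^ s ≤ (1 + ‖q.2‖) ^ N := by
      calc ‖q.2‖ ^ s ≤ (1 + ‖q.2‖) ^ s :=
            Real.rpow_le_rpow (norm_nonneg _) (by linarith) hs0
        _ ≤ (1 + ‖q.2‖) ^ (N : ℝ) := Real.rpow_le_rpow_of_exponent_le hr1 hsN
        _ = _ := Real.rpow_natCast _ _
    have hρq : ρ q.2 = ((1 + ‖q.2‖) ^ (N + 1))⁻¹ := by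
      simp only [hρ]
      rw [Real.rpow_neg hr0.le]
      congr 1
      exact_mod_cast Real.rpow_natCast (1 + ‖q.2‖) (N + 1)
    have hGn : ‖G q‖ = D * (‖g q.1 q.2‖ * ‖q.2‖ ^ s) := by
      simp only [hG, norm_mul, norm_osc, one_mul, Complex.norm_real, Real.norm_eq_abs]
      rw [abs_of_pos hDpos, abs_of_nonneg (by positivity)]
    rw [hρq, hGn, ← div_eq_mul_inv, le_div_iff₀ (by positivity)]
    calc ‖q.2‖ ^ n * (D * (‖g q.1 q.2‖ * ‖q.2‖ ^ s)) * (1 + ‖q.2‖) ^ (N + 1)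
        ≤ ‖q.2‖ ^ n * (D * ((C * Real.exp (-(assocFn Mseq (c * ‖q.2‖)))) *
            (1 + ‖q.2‖) ^ N)) * (1 + ‖q.2‖) ^ (N + 1) := by gcongr
      _ = D * C * ((1 + ‖q.2‖) ^ (2 * N + 1) *
            (‖q.2‖ ^ n * Real.exp (-(assocFn Mseq (c * ‖q.2‖))))) := by ring
      _ ≤ D * C * (B * h ^ n * Mseq n) := by gcongr
      _ = _ := by ring
  have hadm : Adm μ (fun q => q.2) G := by
    refine ⟨measurable_snd, hGm, fun n => ?_⟩
    refine Integrable.mono' (hρi.const_mul (D * C * B * h ^ n * Mseq n)) ?_ ?_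
    · exact ((measurable_snd.norm.pow_const n).aestronglyMeasurable).mul hGm.norm
    · filter_upwards [hbound n] with q hq
      rwa [Real.norm_of_nonneg (by positivity)]
  have hF : F₁ = oscInt μ (fun q => q.2) G := by
    funext x
    rw [hF₁ x, oscInt, hμ, integral_prod _ (hadm.integrable x), ← integral_smul]
    congr 1
    funext τ
    rw [← integral_smul]
    congr 1
    funext ξ
    have hin : (inner ℝ ξ (x - τ) : ℝ) = inner ℝ ξ x + -(inner ℝ ξ τ) := by
      rw [inner_sub_right, sub_eq_add_neg]
    simp only [hG, dotR_eq_inner, hin, Complex.real_smul,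
      Complex.ofReal_add, mul_add, Complex.exp_add]
    ring
  refine ⟨?_, ?_⟩
  · rw [hF]
    exact contDiff_infty.2 fun n => oscInt_contDiff_nat n G hadm
  · have hI : 0 ≤ ∫ q, ρ q.2 ∂μ := integral_nonneg fun q => by
      simp only [hρ]; positivity
    refine ⟨D * C * B * (1 + ∫ q, ρ q.2 ∂μ), by positivity, h, hh, fun α x => ?_⟩
    have hM := hreg.pos (∑ j, α j)
    rw [hF, pderivMulti]
    refine (pderivList_oscInt_norm hadm _ x).trans ?_
    rw [length_multi]
    refine (integral_mono_ae (hadm.int _) (hρi.const_mul _) (hbound (∑ j, α j))).trans ?_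
    rw [integral_const_mul]
    calc D * C * B * h ^ (∑ j, α j) * Mseq (∑ j, α j) * ∫ q, ρ q.2 ∂μ
        ≤ D * C * B * h ^ (∑ j, α j) * Mseq (∑ j, α j) * (1 + ∫ q, ρ q.2 ∂μ) := by
          gcongr; linarith
      _ = _ := by ring

end
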